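/- arXiv:2408.11661 — 2 statements merged into one kernel-verified Lean document; each statement's English description precedes it below -/
import Mathlib

section
/- Let (S,+) be a semigroup and ∘ : S × S → S be any binary operation. For every finite coloring of S and every D ∈ ℕ, there is a sequence (a_i)_{i≥0} in S such that for each 1 ≤ d ≤ D, the set ⋃ {(((x_1 ∘ x_2) ∘ x_3) ∘ ⋯) ∘ x_d : x_i ∈ FS(a_{m_{i−1}},…,a_{m_i−1}) for each 1 ≤ i ≤ d}, where the union ranges over all integer tuples (m_0,…,m_d) with 0 ≤ m_0 < m_1 < ⋯ < m_d, is monochromatic, where the color of the set may depend on d. -/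
/-- Ordered fold of `op` over the values of `a` along the increasing index list `i :: l`. -/
def foldSeq {S : Type*} (op : S → S → S) (a : ℕ → S) : ℕ → List ℕ → S
  | i, [] => a i
  | i, j :: l => op (a i) (foldSeq op a j l)

/-- `FSIcc op a m n` is the set of "finite sums" (with respect to the operation `op`)
`a α₁ ⋆ a α₂ ⋆ ⋯ ⋆ a αₖ` over nonempty subsets `{α₁ < α₂ < ⋯ < αₖ}` of `{m, …, n}`. -/
def FSIcc {S : Type*} (op : S → S → S) (a : ℕ → S) (m n : ℕ) : Set S :=
  { s | ∃ (i : ℕ) (l : List ℕ), List.Chain (· < ·) i l ∧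
      (∀ j ∈ i :: l, m ≤ j ∧ j ≤ n) ∧ s = foldSeq op a i l }

/-- `leftNest op x n = (((x 0 ∘ x 1) ∘ x 2) ∘ ⋯) ∘ x n`. -/
def leftNest {S : Type*} (op : S → S → S) (x : ℕ → S) : ℕ → S
  | 0 => x 0
  | n + 1 => op (leftNest op x n) (x (n + 1))

open Filter

attribute [local instance] Ultrafilter.add

/-- A map into a finite type is eventually constant along an ultrafilter. -/
theorem Ultrafilter.exists_eventually_eq_of_finite {α β : Type*} [Finite β] (U : Ultrafilter α)
    (f : α → β) : ∃ b, ∀ᶠ x in U, f x = b := by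
  obtain ⟨b, hb⟩ := (U.map f).eq_pure_of_finite
  refine ⟨b, ?_⟩
  have h : ({b} : Set β) ∈ U.map f := by rw [hb]; exact Set.mem_singleton b
  exact h

/-- Along an idempotent ultrafilter one can choose a sequence `a` and finite sets `P n` containing
the finite sums of the first `n` terms, such that the finite sums of the terms from index `m` on
satisfy a prescribed eventual condition depending on `P m`. -/
theorem exists_seq_FSIcc_subset {S : Type*} [AddSemigroup S] (U : Ultrafilter S) (hU : U + U = U)
    (B : Set S → Set S) (hB : ∀ P : Set S, P.Finite → B P ∈ U) :
    ∃ (a : ℕ → S) (P : ℕ → Set S), Monotone P ∧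
      (∀ m n, FSIcc (· + ·) a m n ⊆ P (n + 1)) ∧ ∀ m n, FSIcc (· + ·) a m n ⊆ B (P m) := by
  have exists_elem : ∀ A ∈ U, ∃ x ∈ A, {y | x + y ∈ A} ∈ U := fun A hA => by
    have h : ∀ᶠ x in U, ∀ᶠ y in U, x + y ∈ A := by
      rw [← Ultrafilter.eventually_add, hU]
      exact hA
    obtain ⟨x, hx, hy⟩ := Ultrafilter.nonempty_of_mem (inter_mem hA h)
    exact ⟨x, hx, hy⟩
  have : Nonempty S := nonempty_of_neBot (U : Filter S)
  choose! elem elem_mem elem_add using exists_elem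
  let next (P A : Set S) : Set S := P ∪ {elem A} ∪ (· + elem A) '' P
  let succ (p : Set S × Set S) : Set S × Set S :=
    (next p.1 p.2, (p.2 ∩ {y | elem p.2 + y ∈ p.2}) ∩ B (next p.1 p.2))
  let state (n : ℕ) : Set S × Set S := succ^[n] (∅, B ∅)
  have state_succ (n : ℕ) : state (n + 1) = succ (state n) := Function.iterate_succ_apply' _ _ _
  let P (n : ℕ) : Set S := (state n).1
  let A (n : ℕ) : Set S := (state n).2
  let a (n : ℕ) : S := elem (A n)
  have P_succ (n : ℕ) : P (n + 1) = P n ∪ {a n} ∪ (· + a n) '' P n :=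
    congrArg Prod.fst (state_succ n)
  have A_succ (n : ℕ) : A (n + 1) = (A n ∩ {y | a n + y ∈ A n}) ∩ B (P (n + 1)) := by
    rw [P_succ]
    exact congrArg Prod.snd (state_succ n)
  have P_finite (n : ℕ) : (P n).Finite := by
    induction n with
    | zero => exact Set.finite_empty
    | succ n ih =>
      rw [P_succ]
      exact (ih.union (Set.finite_singleton _)).union (ih.image _)
  have A_mem (n : ℕ) : A n ∈ U := by
    induction n with
    | zero => exact hB _ Set.finite_empty
    | succ n ih =>
      rw [A_succ]
      exact inter_mem (inter_mem ih (elem_add _ ih)) (hB _ (P_finite _))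
  have A_subset (n : ℕ) : A n ⊆ B (P n) := by
    cases n with
    | zero => exact subset_rfl
    | succ n =>
      rw [A_succ]
      exact Set.inter_subset_right
  have P_mono : Monotone P := monotone_nat_of_le_succ fun n => by
    rw [P_succ]
    exact fun x hx => Or.inl (Or.inl hx)
  have A_anti : Antitone A := antitone_nat_of_succ_le fun n => by
    rw [A_succ]
    exact fun x hx => hx.1.1
  have a_mem_P (n : ℕ) : a n ∈ P (n + 1) := by
    rw [P_succ]
    exact Or.inl (Or.inr rfl)
  have add_mem_P (n : ℕ) (s : S) (hs : s ∈ P n) : s + a n ∈ P (n + 1) := by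
    rw [P_succ]
    exact Or.inr ⟨s, hs, rfl⟩
  have fold_mem_A (l : List ℕ) : ∀ i, (i :: l).IsChain (· < ·) → foldSeq (· + ·) a i l ∈ A i := by
    induction l with
    | nil => exact fun i _ => elem_mem _ (A_mem i)
    | cons j l ih =>
      intro i h
      obtain ⟨hij, hl⟩ := List.isChain_cons_cons.1 h
      have h' := A_anti (Nat.succ_le_of_lt hij) (ih j hl)
      rw [A_succ] at h'
      exact h'.1.2
  have fold_mem_P (n : ℕ) (l : List ℕ) : ∀ i, (i :: l).IsChain (· < ·) →
      (∀ j ∈ i :: l, j ≤ n) → foldSeq (· + ·) a i l ∈ P (n + 1) ∧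
        ∀ s ∈ P i, s + foldSeq (· + ·) a i l ∈ P (n + 1) := by
    induction l with
    | nil =>
      intro i _ hn
      have hi : P (i + 1) ⊆ P (n + 1) := P_mono (Nat.succ_le_succ (hn i (by simp)))
      exact ⟨hi (a_mem_P i), fun s hs => hi (add_mem_P i s hs)⟩
    | cons j l ih =>
      intro i h hn
      obtain ⟨hij, hl⟩ := List.isChain_cons_cons.1 h
      have hj := (ih j hl fun k hk => hn k (List.mem_cons_of_mem _ hk)).2
      have hP : P (i + 1) ⊆ P j := P_mono (Nat.succ_le_of_lt hij)
      refine ⟨hj _ (hP (a_mem_P i)), fun s hs => ?_⟩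
      have h' := hj _ (hP (add_mem_P i s hs))
      rwa [add_assoc] at h'
  refine ⟨a, P, P_mono, ?_, ?_⟩
  · rintro m n _ ⟨i, l, hl, hmem, rfl⟩
    exact (fold_mem_P n l i hl fun j hj => (hmem j hj).2).1
  · rintro m n _ ⟨i, l, hl, hmem, rfl⟩
    exact A_subset m (A_anti (hmem i (by simp)).1 (fold_mem_A l i hl))

/-- The values of `leftNest op x n` with all `x i` in `P`. -/
def leftNestSet {S : Type*} (op : S → S → S) (P : Set S) : ℕ → Set S
  | 0 => P
  | n + 1 => Set.image2 op (leftNestSet op P n) P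

theorem leftNestSet_finite {S : Type*} (op : S → S → S) {P : Set S} (hP : P.Finite) (n : ℕ) :
    (leftNestSet op P n).Finite := by
  induction n with
  | zero => exact hP
  | succ n ih => exact ih.image2 op hP

theorem leftNestSet_mono {S : Type*} (op : S → S → S) {P Q : Set S} (h : P ⊆ Q) (n : ℕ) :
    leftNestSet op P n ⊆ leftNestSet op Q n := by
  induction n with
  | zero => exact h
  | succ n ih => exact Set.image2_subset ih h

theorem stmt6 {S : Type*} [AddSemigroup S] [Nonempty S] (op : S → S → S)
    (c : ℕ) (col : S → Fin c) (D : ℕ) (hD : 0 < D) :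
    ∃ a : ℕ → S, ∀ d : ℕ, 1 ≤ d → d ≤ D → ∃ i0 : Fin c,
      ∀ y : S,
        (∃ (x : ℕ → S) (m : ℕ → ℕ),
            (∀ i, i < d → m i < m (i + 1)) ∧
            (∀ i, i < d → x i ∈ FSIcc (· + ·) a (m i) (m (i + 1) - 1)) ∧
            y = leftNest op x (d - 1)) →
          col y = i0 := by
  obtain ⟨U, hU⟩ := @exists_idempotent_of_compact_t2_of_continuous_add_left (Ultrafilter S) _
    Ultrafilter.addSemigroup _ _ _ (@Ultrafilter.continuous_add_left S _)
  choose lim lim_spec using fun f : S → Fin c => U.exists_eventually_eq_of_finite f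
  -- `F k y` is the limit colour of `((y ∘ x₁) ∘ ⋯) ∘ xₖ` as `xₖ`, …, `x₁` tend to `U`.
  let F (k : ℕ) : S → Fin c := (fun f y => lim fun x => f (op y x))^[k] col
  have F_succ (k : ℕ) (y : S) : F (k + 1) y = lim fun x => F k (op y x) :=
    congrFun (Function.iterate_succ_apply' _ k col) y
  let Good (j : ℕ) (y : S) : Prop := ∀ k < D - j, F k y = lim (F (j + k))
  have good_zero : ∀ᶠ x in U, Good 0 x :=
    (eventually_all_finite (Set.finite_lt_nat _)).2 fun k _ => by
      rw [Nat.zero_add]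
      exact lim_spec (F k)
  have good_succ (j : ℕ) (y : S) (hy : Good j y) : ∀ᶠ x in U, Good (j + 1) (op y x) :=
    (eventually_all_finite (Set.finite_lt_nat _)).2 fun k hk => by
      have hk' : k < D - (j + 1) := hk
      have h := hy (k + 1) (by omega)
      rw [F_succ] at h
      rw [show j + 1 + k = j + (k + 1) by omega, ← h]
      exact lim_spec fun x => F k (op y x)
  let B (P : Set S) : Set S :=
    {x | Good 0 x ∧ ∀ j < D, ∀ y ∈ leftNestSet op P j, Good j y → Good (j + 1) (op y x)}
  have hB (P : Set S) (hP : P.Finite) : B P ∈ U :=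
    good_zero.and <| (eventually_all_finite (Set.finite_lt_nat D)).2 fun j _ =>
      (eventually_all_finite (leftNestSet_finite op hP j)).2 fun y _ =>
        eventually_imp_distrib_left.2 (good_succ j y)
  obtain ⟨a, P, P_mono, sum_mem_P, sum_mem_B⟩ := exists_seq_FSIcc_subset U hU B hB
  refine ⟨a, fun d hd hdD => ⟨lim (F (d - 1)), ?_⟩⟩
  rintro _ ⟨x, m, hm, hx, rfl⟩
  have x_mem_P (e : ℕ) (he : e < d) : x e ∈ P (m (e + 1)) := by
    have h := sum_mem_P _ _ (hx e he)
    rwa [Nat.sub_add_cancel (Nat.one_le_of_lt (hm e he))] at h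
  have key (e : ℕ) (he : e < d) :
      leftNest op x e ∈ leftNestSet op (P (m (e + 1))) e ∧ Good e (leftNest op x e) := by
    induction e with
    | zero => exact ⟨x_mem_P 0 he, (sum_mem_B _ _ (hx 0 he)).1⟩
    | succ e ih =>
      obtain ⟨hmem, hgood⟩ := ih (by omega)
      exact ⟨⟨_, leftNestSet_mono op (P_mono (hm _ he).le) e hmem, _, x_mem_P _ he, rfl⟩,
        (sum_mem_B _ _ (hx _ he)).2 e (by omega) _ hmem hgood⟩
  exact (key (d - 1) (by omega)).2 0 (by omega)
end

section
/- For any binary operation ∘ : ℕ × ℕ → ℕ and any finite coloring of the positive integers ℕ, there is a sequence (a_i)_{i≥0} in ℕ such that the set ⋃_{m_0 ∈ ℕ} ⋃_{d ∈ FS(a_0,…,a_{m_0−1})} ⋃_{(m_1,…,m_d) ∈ ℕ^d, m_0 < m_1 < ⋯ < m_d} {(((x_1 ∘ x_2) ∘ x_3) ∘ ⋯) ∘ x_d : x_i ∈ FS(a_{m_{i−1}},…,a_{m_i−1}) for each 1 ≤ i ≤ d} is monochromatic. -/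
open Filter

/-- On the positive integers there is an ultrafilter `U` with `U ⊆ U + U`. -/
theorem exists_ultrafilter_eventually_add :
    ∃ U : Ultrafilter ℕ+, ∀ p : ℕ+ → Prop,
      (∀ᶠ x in U, p x) → ∀ᶠ x in U, ∀ᶠ y in U, p (x + y) := by
  obtain ⟨U, hU, -⟩ := Hindman.exists_idempotent_ultrafilter_le_FS (fun _ => 1 : Stream' ℕ+)
  refine ⟨U, fun p hp => ?_⟩
  rw [← Ultrafilter.eventually_add, hU]
  exact hp

section Automaton

variable {M σ : Type*} [AddSemigroup M]

/-- Extend a possibly empty partial sum by one summand. -/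
def addPartial : Option M → M → M
  | none, x => x
  | some z, x => z + x

theorem addPartial_some_addPartial (o : Option M) (x y : M) :
    addPartial (some (addPartial o x)) y = addPartial o (x + y) := by
  cases o <;> simp [addPartial, add_assoc]

/-- A configuration consists of a state and the partial sum of the block being read. It is large
when its state is good if the block is empty, and otherwise when closing the block leads to a good
state, both at once and after `U`-almost all further summands. -/
def LargeConfig (U : Ultrafilter M) (next : σ → M → σ) (good : σ → Prop) :
    σ × Option M → Prop
  | (s, none) => good s
  | (s, some x) => good (next s x) ∧ ∀ᶠ y in U, good (next s (x + y))

/-- The configurations reachable from `C` after reading the letter `x`: skip it, add it to the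
current block, or add it and close the block. -/
def readLetter (next : σ → M → σ) (C : Set (σ × Option M)) (x : M) : Set (σ × Option M) :=
  C ∪ ((fun t => (t.1, some (addPartial t.2 x))) '' C ∪
    (fun t => (next t.1 (addPartial t.2 x), none)) '' C)

theorem LargeConfig.eventually_addPartial {U : Ultrafilter M} {next : σ → M → σ}
    {good : σ → Prop}
    (hU : ∀ p : M → Prop, (∀ᶠ x in U, p x) → ∀ᶠ x in U, ∀ᶠ y in U, p (x + y))
    (hnext : ∀ s, good s → ∀ᶠ x in U, good (next s x)) {t : σ × Option M}
    (ht : LargeConfig U next good t) :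
    ∀ᶠ x in U, LargeConfig U next good (t.1, some (addPartial t.2 x)) := by
  obtain ⟨s, _ | z⟩ := t
  · exact (hnext s ht).and (hU _ (hnext s ht))
  · have h := hU _ ht.2
    filter_upwards [ht.2, h] with x hx hxy
    exact ⟨hx, by simpa only [addPartial, add_assoc] using hxy⟩

/-- A sequence of letters whose reachable configurations are all large. -/
theorem exists_seq_largeConfig {U : Ultrafilter M} {next : σ → M → σ} {good : σ → Prop}
    (hU : ∀ p : M → Prop, (∀ᶠ x in U, p x) → ∀ᶠ x in U, ∀ᶠ y in U, p (x + y))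
    (hnext : ∀ s, good s → ∀ᶠ x in U, good (next s x)) {s₀ : σ} (hs₀ : good s₀) :
    ∃ (a : ℕ → M) (C : ℕ → Set (σ × Option M)), (s₀, none) ∈ C 0 ∧
      (∀ n, C (n + 1) = readLetter next (C n) (a n)) ∧
      ∀ n, ∀ t ∈ C n, LargeConfig U next good t := by
  let X := {C : Set (σ × Option M) // C.Finite ∧ ∀ t ∈ C, LargeConfig U next good t}
  have hchoice : ∀ C : X, ∃ x, ∀ t ∈ C.1,
      LargeConfig U next good (t.1, some (addPartial t.2 x)) := fun C =>
    ((eventually_all_finite C.2.1).2 fun t ht =>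
      (C.2.2 t ht).eventually_addPartial hU hnext).exists
  choose f hf using hchoice
  let step : X → X := fun C => ⟨readLetter next C.1 (f C),
    C.2.1.union ((C.2.1.image _).union (C.2.1.image _)), by
      rintro _ (ht | ⟨t, ht, rfl⟩ | ⟨t, ht, rfl⟩)
      · exact C.2.2 _ ht
      · exact hf C t ht
      · exact (hf C t ht).1⟩
  let start : X := ⟨{(s₀, none)}, Set.finite_singleton _, by rintro _ rfl; exact hs₀⟩
  let C : ℕ → X := fun n => step^[n] start
  refine ⟨fun n => f (C n), fun n => (C n).1, rfl, fun n => ?_, fun n => (C n).2.2⟩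
  change (step^[n + 1] start).1 = _
  rw [Function.iterate_succ_apply']

variable {next : σ → M → σ} {a : ℕ → M} {C : ℕ → Set (σ × Option M)}

theorem mem_readLetter_foldSeq (hC : ∀ n, C (n + 1) = readLetter next (C n) (a n))
    {s : σ} {N : ℕ} (l : List ℕ) : ∀ {i n : ℕ} {o : Option M}, (s, o) ∈ C n → n ≤ i →
      (i :: l).IsChain (· < ·) → (∀ j ∈ i :: l, j < N) →
      (next s (addPartial o (foldSeq (· + ·) a i l)), none) ∈ C N := by
  have hmono : Monotone C := monotone_nat_of_le_succ fun n => by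
    rw [hC]; exact Set.subset_union_left
  induction l with
  | nil =>
    intro i n o hs hni _ hN
    refine hmono (Nat.succ_le_of_lt (hN i (by simp))) ?_
    rw [hC]
    exact Or.inr (Or.inr ⟨_, hmono hni hs, rfl⟩)
  | cons j l ih =>
    intro i n o hs hni hch hN
    have hmem : (s, some (addPartial o (a i))) ∈ C (i + 1) := by
      rw [hC]
      exact Or.inr (Or.inl ⟨_, hmono hni hs, rfl⟩)
    rw [List.isChain_cons_cons] at hch
    have h := ih hmem hch.1 hch.2 fun k hk => hN k (List.mem_cons_of_mem _ hk)
    rwa [addPartial_some_addPartial] at h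

theorem mem_readLetter_of_mem_FSIcc (hC : ∀ n, C (n + 1) = readLetter next (C n) (a n))
    {s : σ} {m n : ℕ} (hmn : m < n) (hs : (s, none) ∈ C m) {x : M}
    (hx : x ∈ FSIcc (· + ·) a m (n - 1)) : (next s x, none) ∈ C n := by
  obtain ⟨i, l, hch, hl, rfl⟩ := hx
  exact mem_readLetter_foldSeq hC l hs (hl i (by simp)).1 hch
    fun j hj => by have := (hl j hj).2; omega

end Automaton

section Nesting

/-- The states of the automaton evaluating left-nested expressions: `start` awaits the number of
arguments, `count k` awaits the first of `k + 1` arguments, and `value k y` has the value `y` so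
far and awaits `k` further arguments. -/
inductive NestState
  | start
  | count (k : ℕ)
  | value (k : ℕ) (y : ℕ+)

/-- The transitions of the automaton evaluating left-nested expressions. -/
def NestState.next (op : ℕ+ → ℕ+ → ℕ+) : NestState → ℕ+ → NestState
  | start, d => count (d - 1)
  | count k, x => value k x
  | value 0 y, _ => value 0 y
  | value (k + 1) y, x => value k (op y x)

/-- For `U`-almost all `x₁`, …, for `U`-almost all `xₖ`, the value of
`((y ∘ x₁) ∘ ⋯) ∘ xₖ` lies in `A`. -/
def NestLarge (U : Ultrafilter ℕ+) (op : ℕ+ → ℕ+ → ℕ+) (A : Set ℕ+) : ℕ → ℕ+ → Prop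
  | 0, y => y ∈ A
  | k + 1, y => ∀ᶠ x in U, NestLarge U op A k (op y x)

theorem exists_nestLarge {ι : Type*} [Finite ι] (U : Ultrafilter ℕ+) (op : ℕ+ → ℕ+ → ℕ+)
    (col : ℕ+ → ι) (k : ℕ) : ∀ y, ∃ i, NestLarge U op (col ⁻¹' {i}) k y := by
  induction k with
  | zero => exact fun y => ⟨col y, rfl⟩
  | succ k ih =>
    exact fun y => Ultrafilter.eventually_exists_iff.1 (Eventually.of_forall fun _ => ih _)

/-- The states from which `U`-almost all continuations evaluate to an element of `A`. -/
def NestState.Good (U : Ultrafilter ℕ+) (op : ℕ+ → ℕ+ → ℕ+) (A : Set ℕ+) : NestState → Prop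
  | start => ∀ᶠ d : ℕ+ in U, ∀ᶠ x in U, NestLarge U op A (d - 1) x
  | count k => ∀ᶠ x in U, NestLarge U op A k x
  | value k y => NestLarge U op A k y

theorem NestState.Good.eventually_next {U : Ultrafilter ℕ+} {op : ℕ+ → ℕ+ → ℕ+} {A : Set ℕ+} :
    ∀ s : NestState, s.Good U op A → ∀ᶠ x in U, (s.next op x).Good U op A
  | start, h => h
  | count _, h => h
  | value 0 _, h => Eventually.of_forall fun _ => h
  | value (_ + 1) _, h => h

theorem exists_good_start {ι : Type*} [Finite ι] (U : Ultrafilter ℕ+) (op : ℕ+ → ℕ+ → ℕ+)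
    (col : ℕ+ → ι) : ∃ i, NestState.start.Good U op (col ⁻¹' {i}) :=
  Ultrafilter.eventually_exists_iff.1 <| Eventually.of_forall fun _ =>
    Ultrafilter.eventually_exists_iff.1 <| Eventually.of_forall fun x =>
      exists_nestLarge U op col _ x

end Nesting

theorem stmt8 (op : ℕ+ → ℕ+ → ℕ+) (c : ℕ) (col : ℕ+ → Fin c) :
    ∃ a : ℕ → ℕ+, ∃ i0 : Fin c,
      ∀ y : ℕ+,
        (∃ m0 : ℕ, 0 < m0 ∧
          ∃ d : ℕ+, d ∈ FSIcc (· + ·) a 0 (m0 - 1) ∧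
            ∃ (x : ℕ → ℕ+) (m : ℕ → ℕ),
              m 0 = m0 ∧
              (∀ i, i < (d : ℕ) → m i < m (i + 1)) ∧
              (∀ i, i < (d : ℕ) → x i ∈ FSIcc (· + ·) a (m i) (m (i + 1) - 1)) ∧
              y = leftNest op x ((d : ℕ) - 1)) →
          col y = i0 := by
  obtain ⟨U, hU⟩ := exists_ultrafilter_eventually_add
  obtain ⟨i0, hi0⟩ := exists_good_start U op col
  obtain ⟨a, C, hC0, hC, hlarge⟩ :=
    exists_seq_largeConfig hU (NestState.Good.eventually_next (op := op)) hi0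
  refine ⟨a, i0, ?_⟩
  rintro _ ⟨_, hm0, d, hd, x, m, rfl, hm, hx, rfl⟩
  have hcount := mem_readLetter_of_mem_FSIcc hC hm0 hC0 hd
  have hvalue : ∀ i, i < (d : ℕ) →
      (NestState.value (d - 1 - i) (leftNest op x i), none) ∈ C (m (i + 1)) := by
    intro i
    induction i with
    | zero => exact fun hi => mem_readLetter_of_mem_FSIcc hC (hm 0 hi) hcount (hx 0 hi)
    | succ i ih =>
      intro hi
      have h := mem_readLetter_of_mem_FSIcc hC (hm _ hi) (ih (by omega)) (hx _ hi)
      obtain ⟨k, hk⟩ : ∃ k, (d : ℕ) - 1 - i = k + 1 := ⟨d - 1 - (i + 1), by omega⟩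
      rw [hk] at h
      rw [show (d : ℕ) - 1 - (i + 1) = k by omega]
      exact h
  have h := hlarge _ _ (hvalue (d - 1) (Nat.sub_lt d.pos one_pos))
  rw [Nat.sub_self] at h
  exact h
end
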